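/- arXiv:2501.13637 — 13 statements merged into one kernel-verified Lean document; each statement's English description precedes it below -/
import Mathlib

section
/- Let H be a real Hilbert space, F : H ⇉ H a set-valued operator, v : H → H a single-valued map, and γ > 0. If the pair (F, v) is monotone, then the transformed resolvent T_{γF}^v is single-valued and firmly nonexpansive on its domain: for all x₁, x₂ ∈ H and all y₁ ∈ T_{γF}^v(x₁), y₂ ∈ T_{γF}^v(x₂), one has ‖y₁ − y₂‖² ≤ ⟨x₁ − x₂, y₁ − y₂⟩; in particular, if x₁ = x₂ then y₁ = y₂. -/
open RealInnerProductSpace Pointwise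

/-- The transformed resolvent of `γF` with respect to `v`:
`T_{γF}^v(x) = {v(z) : z ∈ H, x − v(z) ∈ γF(z)}`. -/
def transformedResolvent {H : Type*} [NormedAddCommGroup H] [InnerProductSpace ℝ H]
    (F : H → Set H) (v : H → H) (γ : ℝ) (x : H) : Set H :=
  {w | ∃ z : H, x - v z ∈ γ • F z ∧ w = v z}

/-- The pair `(F, v)` is monotone. -/
def MonotonePair {H : Type*} [NormedAddCommGroup H] [InnerProductSpace ℝ H]
    (F : H → Set H) (v : H → H) : Prop :=
  ∀ x y : H, ∀ u ∈ F x, ∀ w ∈ F y, 0 ≤ ⟪u - w, v x - v y⟫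

theorem transformedResolvent_firmlyNonexpansive
    {H : Type*} [NormedAddCommGroup H] [InnerProductSpace ℝ H] [CompleteSpace H]
    (F : H → Set H) (v : H → H) (γ : ℝ) (hγ : 0 < γ)
    (hmono : MonotonePair F v) :
    (∀ x₁ x₂ y₁ y₂ : H, y₁ ∈ transformedResolvent F v γ x₁ →
      y₂ ∈ transformedResolvent F v γ x₂ →
      ‖y₁ - y₂‖ ^ 2 ≤ ⟪x₁ - x₂, y₁ - y₂⟫) ∧
    (∀ x y₁ y₂ : H, y₁ ∈ transformedResolvent F v γ x →
      y₂ ∈ transformedResolvent F v γ x → y₁ = y₂) := by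
  have key : ∀ x₁ x₂ y₁ y₂ : H, y₁ ∈ transformedResolvent F v γ x₁ →
      y₂ ∈ transformedResolvent F v γ x₂ →
      ‖y₁ - y₂‖ ^ 2 ≤ ⟪x₁ - x₂, y₁ - y₂⟫ := by
    rintro x₁ x₂ _ _ ⟨z₁, ⟨u₁, hu₁, h₁⟩, rfl⟩ ⟨z₂, ⟨u₂, hu₂, h₂⟩, rfl⟩
    have hx : x₁ - x₂ = γ • (u₁ - u₂) + (v z₁ - v z₂) := by
      rw [smul_sub, show γ • u₁ = x₁ - v z₁ from h₁, show γ • u₂ = x₂ - v z₂ from h₂]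
      abel
    rw [hx, inner_add_left, real_inner_smul_left, real_inner_self_eq_norm_sq]
    exact le_add_of_nonneg_left (mul_nonneg hγ.le (hmono z₁ z₂ u₁ hu₁ u₂ hu₂))
  refine ⟨key, fun x y₁ y₂ h₁ h₂ => ?_⟩
  have h := key x x y₁ y₂ h₁ h₂
  rw [sub_self, inner_zero_left] at h
  exact sub_eq_zero.mp (norm_eq_zero.mp (sq_nonpos_iff _ |>.mp h))
end

section
/- Let H be a real Hilbert space, F : H ⇉ H a set-valued operator, v : H → H a single-valued map, γ > 0, α > 0, and L ≥ 0. If the pair (F, v) is α-strongly monotone and v is L-Lipschitz continuous, then the transformed resolvent T_{γF}^v is Lipschitz continuous with constant 1/(1 + αγL⁻²) < 1 on its domain: for all x₁, x₂ ∈ H and all y₁ ∈ T_{γF}^v(x₁), y₂ ∈ T_{γF}^v(x₂), one has ‖y₁ − y₂‖ ≤ (1/(1 + αγL⁻²)) ‖x₁ − x₂‖. -/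
open RealInnerProductSpace Pointwise

/-- The pair `(F, v)` is `α`-strongly monotone. -/
def StronglyMonotonePair {H : Type*} [NormedAddCommGroup H] [InnerProductSpace ℝ H]
    (F : H → Set H) (v : H → H) (α : ℝ) : Prop :=
  ∀ x y : H, ∀ u ∈ F x, ∀ w ∈ F y, α * ‖x - y‖ ^ 2 ≤ ⟪u - w, v x - v y⟫

theorem transformedResolvent_contraction
    {H : Type*} [NormedAddCommGroup H] [InnerProductSpace ℝ H] [CompleteSpace H]
    (F : H → Set H) (v : H → H) (γ α L : ℝ) (hγ : 0 < γ) (hα : 0 < α) (hL : 0 ≤ L)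
    (hmono : StronglyMonotonePair F v α)
    (hlip : ∀ x y : H, ‖v x - v y‖ ≤ L * ‖x - y‖) :
    ∀ x₁ x₂ y₁ y₂ : H, y₁ ∈ transformedResolvent F v γ x₁ →
      y₂ ∈ transformedResolvent F v γ x₂ →
      ‖y₁ - y₂‖ ≤ (1 + α * γ * (L ^ 2)⁻¹)⁻¹ * ‖x₁ - x₂‖ := by
  rintro x₁ x₂ _ _ ⟨z₁, ⟨u₁, hu₁, hx₁⟩, rfl⟩ ⟨z₂, ⟨u₂, hu₂, hx₂⟩, rfl⟩
  set d := v z₁ - v z₂ with hd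
  set c := α * γ * (L ^ 2)⁻¹ with hc
  have hc0 : 0 ≤ c := by positivity
  have hz : (L ^ 2)⁻¹ * ‖d‖ ^ 2 ≤ ‖z₁ - z₂‖ ^ 2 := by
    rcases hL.eq_or_lt with rfl | hL
    · simp
    · rw [inv_mul_le_iff₀ (by positivity), ← mul_pow]
      gcongr
      exact hlip z₁ z₂
  have hdiff : x₁ - x₂ = γ • (u₁ - u₂) + d := by
    simp only at hx₁ hx₂
    rw [smul_sub, hx₁, hx₂, hd]
    abel
  have hinner : (1 + c) * ‖d‖ ^ 2 ≤ ⟪x₁ - x₂, d⟫ := by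
    rw [hdiff, inner_add_left, real_inner_smul_left, real_inner_self_eq_norm_sq]
    have hm := mul_le_mul_of_nonneg_left (hmono z₁ z₂ u₁ hu₁ u₂ hu₂) hγ.le
    have hz' := mul_le_mul_of_nonneg_left hz (mul_pos hα hγ).le
    rw [← hd] at hm
    linarith
  rw [← div_eq_inv_mul, le_div_iff₀ (by positivity)]
  rcases (norm_nonneg d).eq_or_lt with h0 | hpos
  · simp [← h0]
  · refine le_of_mul_le_mul_right ?_ hpos
    linarith [real_inner_le_norm (x₁ - x₂) d]
end

section
/- Let H be a real Hilbert space, F : H ⇉ H a set-valued operator, v : H → H an injective single-valued map, and γ > 0. Suppose the pair (F, v) is monotone and ran v ⊆ ran(γF + v). Then the warped resolvent J_{γF}^v has full domain (for every x ∈ H the set J_{γF}^v(x) is nonempty) and is single-valued: for all x ∈ H and y₁, y₂ ∈ J_{γF}^v(x), y₁ = y₂. -/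
open RealInnerProductSpace Pointwise

/-- The warped resolvent of `γF` with kernel `v`:
`J_{γF}^v(x) = {z ∈ H : v(x) − v(z) ∈ γF(z)}`. -/
def warpedResolvent {H : Type*} [NormedAddCommGroup H] [InnerProductSpace ℝ H]
    (F : H → Set H) (v : H → H) (γ : ℝ) (x : H) : Set H :=
  {z | v x - v z ∈ γ • F z}

theorem warpedResolvent_singleValued_fullDomain
    {H : Type*} [NormedAddCommGroup H] [InnerProductSpace ℝ H] [CompleteSpace H]
    (F : H → Set H) (v : H → H) (γ : ℝ) (hγ : 0 < γ)
    (hinj : Function.Injective v)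
    (hmono : MonotonePair F v)
    (hran : Set.range v ⊆ {w : H | ∃ z : H, ∃ u ∈ F z, w = γ • u + v z}) :
    (∀ x : H, (warpedResolvent F v γ x).Nonempty) ∧
    (∀ x y₁ y₂ : H, y₁ ∈ warpedResolvent F v γ x → y₂ ∈ warpedResolvent F v γ x →
      y₁ = y₂) := by
  refine ⟨fun x => ?_, fun x y₁ y₂ h₁ h₂ => ?_⟩
  · obtain ⟨z, u, hu, h⟩ := hran ⟨x, rfl⟩
    exact ⟨z, u, hu, eq_sub_of_add_eq h.symm⟩
  · obtain ⟨u, hu, hxu : γ • u = v x - v y₁⟩ := h₁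
    obtain ⟨w, hw, hxw : γ • w = v x - v y₂⟩ := h₂
    have hv : v y₁ - v y₂ = -(γ • (u - w)) := by
      rw [smul_sub, hxu, hxw]
      abel
    have hnonneg := hmono y₁ y₂ u hu w hw
    rw [hv, inner_neg_right, real_inner_smul_right, real_inner_self_eq_norm_sq] at hnonneg
    have hnorm : ‖u - w‖ ^ 2 = 0 := by
      nlinarith [sq_nonneg ‖u - w‖]
    have huw : u - w = 0 := by simpa using hnorm
    exact hinj (sub_eq_zero.mp (by rw [hv, huw, smul_zero, neg_zero]))
end

section
/- Let H be a real Hilbert space, F : H ⇉ H a set-valued operator, v : H → H a single-valued map, γ > 0, and α > 0. If the pair (F, v) is α-strongly monotone, then for all x₁, x₂ ∈ H and all y₁ ∈ J_{γF}^v(x₁), y₂ ∈ J_{γF}^v(x₂), one has αγ‖y₁ − y₂‖² + ‖v(y₁) − v(y₂)‖² ≤ ⟨v(x₁) − v(x₂), v(y₁) − v(y₂)⟩. -/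
open RealInnerProductSpace Pointwise

theorem warpedResolvent_strong_inequality
    {H : Type*} [NormedAddCommGroup H] [InnerProductSpace ℝ H] [CompleteSpace H]
    (F : H → Set H) (v : H → H) (γ α : ℝ) (hγ : 0 < γ) (hα : 0 < α)
    (hmono : StronglyMonotonePair F v α) :
    ∀ x₁ x₂ y₁ y₂ : H, y₁ ∈ warpedResolvent F v γ x₁ → y₂ ∈ warpedResolvent F v γ x₂ →
      α * γ * ‖y₁ - y₂‖ ^ 2 + ‖v y₁ - v y₂‖ ^ 2 ≤ ⟪v x₁ - v x₂, v y₁ - v y₂⟫ := by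
  rintro x₁ x₂ y₁ y₂ ⟨u₁, hu₁, h₁⟩ ⟨u₂, hu₂, h₂⟩
  have h₁ : γ • u₁ = v x₁ - v y₁ := h₁
  have h₂ : γ • u₂ = v x₂ - v y₂ := h₂
  have hdecomp : v x₁ - v x₂ = γ • (u₁ - u₂) + (v y₁ - v y₂) := by
    rw [smul_sub, h₁, h₂]
    abel
  rw [hdecomp, inner_add_left, real_inner_smul_left, real_inner_self_eq_norm_sq]
  linarith [mul_le_mul_of_nonneg_left (hmono y₁ y₂ u₁ hu₁ u₂ hu₂) hγ.le]
end

section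
/- Let H be a real Hilbert space, F : H ⇉ H a set-valued operator, v : H → H a single-valued map, γ > 0, α > 0, and L > 0. If the pair (F, v) is α-strongly monotone and v is L-Lipschitz continuous, then for all x₁, x₂ ∈ H and all y₁ ∈ J_{γF}^v(x₁), y₂ ∈ J_{γF}^v(x₂), one has ‖v(y₁) − v(y₂)‖ ≤ (1/(1 + αγL⁻²)) ‖v(x₁) − v(x₂)‖. -/
open RealInnerProductSpace Pointwise

theorem warpedResolvent_v_contraction
    {H : Type*} [NormedAddCommGroup H] [InnerProductSpace ℝ H] [CompleteSpace H]
    (F : H → Set H) (v : H → H) (γ α L : ℝ) (hγ : 0 < γ) (hα : 0 < α) (hL : 0 < L)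
    (hmono : StronglyMonotonePair F v α)
    (hlip : ∀ x y : H, ‖v x - v y‖ ≤ L * ‖x - y‖) :
    ∀ x₁ x₂ y₁ y₂ : H, y₁ ∈ warpedResolvent F v γ x₁ → y₂ ∈ warpedResolvent F v γ x₂ →
      ‖v y₁ - v y₂‖ ≤ (1 + α * γ * (L ^ 2)⁻¹)⁻¹ * ‖v x₁ - v x₂‖ := by
  rintro x₁ x₂ y₁ y₂ ⟨u, hu, hux⟩ ⟨w, hw, hwx⟩
  simp only at hux hwx
  have hx : v x₁ - v x₂ = γ • (u - w) + (v y₁ - v y₂) := by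
    rw [smul_sub, hux, hwx]; abel
  have hinner : γ * ⟪u - w, v y₁ - v y₂⟫ + ‖v y₁ - v y₂‖ ^ 2
      ≤ ‖v x₁ - v x₂‖ * ‖v y₁ - v y₂‖ := by
    have h := real_inner_le_norm (v x₁ - v x₂) (v y₁ - v y₂)
    nth_rewrite 1 [hx] at h
    rwa [inner_add_left, real_inner_smul_left, real_inner_self_eq_norm_sq] at h
  have hlip_sq : (L ^ 2)⁻¹ * ‖v y₁ - v y₂‖ ^ 2 ≤ ‖y₁ - y₂‖ ^ 2 := by
    rw [inv_mul_le_iff₀ (by positivity), ← mul_pow]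
    gcongr
    exact hlip y₁ y₂
  have hquad : (1 + α * γ * (L ^ 2)⁻¹) * ‖v y₁ - v y₂‖ ^ 2
      ≤ ‖v x₁ - v x₂‖ * ‖v y₁ - v y₂‖ := by
    have hα_le := mul_le_mul_of_nonneg_left hlip_sq (mul_pos hα hγ).le
    have hγ_le := mul_le_mul_of_nonneg_left (hmono y₁ y₂ u hu w hw) hγ.le
    linarith
  rw [le_inv_mul_iff₀ (by positivity)]
  rcases (norm_nonneg (v y₁ - v y₂)).eq_or_lt with h0 | hpos
  · rw [← h0, mul_zero]
    exact norm_nonneg _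
  · refine le_of_mul_le_mul_right ?_ hpos
    rwa [mul_assoc, ← sq]
end

section
/- Let H be a real Hilbert space, F : H ⇉ H a set-valued operator, γ > 0, α > 0, L > 0, ℓ ≥ 0, and let v : H → H be a bijective single-valued map such that the pair (F, v) is α-strongly monotone, v is L-Lipschitz continuous, and the inverse map v⁻¹ is ℓ-Lipschitz continuous. Then the warped resolvent J_{γF}^v is Lipschitz continuous with constant ℓL/(1 + αγL⁻²): for all x₁, x₂ ∈ H and all y₁ ∈ J_{γF}^v(x₁), y₂ ∈ J_{γF}^v(x₂), one has ‖y₁ − y₂‖ ≤ (ℓL/(1 + αγL⁻²)) ‖x₁ − x₂‖. -/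
open RealInnerProductSpace Pointwise

/-- Applying the kernel to warped resolvents contracts distances by the factor
`1 / (1 + α * γ / L ^ 2)`. -/
theorem StronglyMonotonePair.norm_kernel_sub_le
    {H : Type*} [NormedAddCommGroup H] [InnerProductSpace ℝ H]
    {F : H → Set H} {v : H → H} {γ α L : ℝ} (hγ : 0 ≤ γ) (hα : 0 ≤ α) (hL : 0 < L)
    (hmono : StronglyMonotonePair F v α) (hlip : ∀ x y : H, ‖v x - v y‖ ≤ L * ‖x - y‖)
    {x₁ x₂ y₁ y₂ : H} (h₁ : y₁ ∈ warpedResolvent F v γ x₁)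
    (h₂ : y₂ ∈ warpedResolvent F v γ x₂) :
    (1 + α * γ * (L ^ 2)⁻¹) * ‖v y₁ - v y₂‖ ≤ ‖v x₁ - v x₂‖ := by
  obtain ⟨u, hu, hux : γ • u = v x₁ - v y₁⟩ := h₁
  obtain ⟨w, hw, hwx : γ • w = v x₂ - v y₂⟩ := h₂
  have hsplit : v x₁ - v x₂ = (v y₁ - v y₂) + γ • (u - w) := by
    rw [smul_sub, hux, hwx]; abel
  have hlower : (L ^ 2)⁻¹ * ‖v y₁ - v y₂‖ ^ 2 ≤ ‖y₁ - y₂‖ ^ 2 := by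
    rw [inv_mul_le_iff₀ (by positivity), ← mul_pow]
    gcongr
    exact hlip y₁ y₂
  have hinner : (1 + α * γ * (L ^ 2)⁻¹) * ‖v y₁ - v y₂‖ ^ 2 ≤
      ‖v x₁ - v x₂‖ * ‖v y₁ - v y₂‖ :=
    calc (1 + α * γ * (L ^ 2)⁻¹) * ‖v y₁ - v y₂‖ ^ 2
        = ‖v y₁ - v y₂‖ ^ 2 + γ * (α * ((L ^ 2)⁻¹ * ‖v y₁ - v y₂‖ ^ 2)) := by ring
      _ ≤ ‖v y₁ - v y₂‖ ^ 2 + γ * (α * ‖y₁ - y₂‖ ^ 2) := by gcongr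
      _ ≤ ‖v y₁ - v y₂‖ ^ 2 + γ * ⟪u - w, v y₁ - v y₂⟫ := by
        gcongr
        exact hmono y₁ y₂ u hu w hw
      _ = ⟪v x₁ - v x₂, v y₁ - v y₂⟫ := by
        rw [hsplit, inner_add_left, real_inner_smul_left, real_inner_self_eq_norm_sq]
      _ ≤ ‖v x₁ - v x₂‖ * ‖v y₁ - v y₂‖ := real_inner_le_norm _ _
  rcases (norm_nonneg (v y₁ - v y₂)).eq_or_lt with h | h
  · simp [← h]
  · refine le_of_mul_le_mul_right ?_ h
    rwa [mul_assoc, ← sq]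

theorem warpedResolvent_lipschitz
    {H : Type*} [NormedAddCommGroup H] [InnerProductSpace ℝ H] [CompleteSpace H]
    (F : H → Set H) (v vinv : H → H) (γ α L ℓ : ℝ)
    (hγ : 0 < γ) (hα : 0 < α) (hL : 0 < L) (hℓ : 0 ≤ ℓ)
    (hbij : Function.Bijective v)
    (hvinv_left : Function.LeftInverse vinv v)
    (hvinv_right : Function.RightInverse vinv v)
    (hmono : StronglyMonotonePair F v α)
    (hlip : ∀ x y : H, ‖v x - v y‖ ≤ L * ‖x - y‖)
    (hlipinv : ∀ x y : H, ‖vinv x - vinv y‖ ≤ ℓ * ‖x - y‖) :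
    ∀ x₁ x₂ y₁ y₂ : H, y₁ ∈ warpedResolvent F v γ x₁ → y₂ ∈ warpedResolvent F v γ x₂ →
      ‖y₁ - y₂‖ ≤ ℓ * L / (1 + α * γ * (L ^ 2)⁻¹) * ‖x₁ - x₂‖ := by
  intro x₁ x₂ y₁ y₂ h₁ h₂
  have hc : 0 < 1 + α * γ * (L ^ 2)⁻¹ := by positivity
  have hkernel := hmono.norm_kernel_sub_le hγ.le hα.le hL hlip h₁ h₂
  have hinv : ‖y₁ - y₂‖ ≤ ℓ * ‖v y₁ - v y₂‖ := by
    simpa only [hvinv_left y₁, hvinv_left y₂] using hlipinv (v y₁) (v y₂)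
  rw [div_mul_eq_mul_div, le_div_iff₀ hc]
  calc ‖y₁ - y₂‖ * (1 + α * γ * (L ^ 2)⁻¹)
      ≤ ℓ * ‖v y₁ - v y₂‖ * (1 + α * γ * (L ^ 2)⁻¹) := by gcongr
    _ = ℓ * ((1 + α * γ * (L ^ 2)⁻¹) * ‖v y₁ - v y₂‖) := by ring
    _ ≤ ℓ * (L * ‖x₁ - x₂‖) :=
      mul_le_mul_of_nonneg_left (hkernel.trans (hlip x₁ x₂)) hℓ
    _ = ℓ * L * ‖x₁ - x₂‖ := by ring
end

section
/- Let H be a real Hilbert space, F : H ⇉ H a set-valued operator with zer F ≠ ∅ and with a strongly-weakly closed graph, and let v : H → H be a bijective single-valued map such that the pair (F, v) is monotone and the inverse map v⁻¹ is weakly continuous. Let (γₙ) be a sequence of positive reals with Σₙ γₙ² = +∞ and ran v ⊆ ran(γₙF + v) for all n. Let (xₙ) be a sequence in H with xₙ₊₁ ∈ J_{γₙF}^v(xₙ) for all n, i.e. v(xₙ) − v(xₙ₊₁) ∈ γₙ F(xₙ₊₁). Then (xₙ) converges weakly to some point x̃ ∈ zer F. -/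
open RealInnerProductSpace Pointwise Filter

/-- Weak convergence of a sequence in a Hilbert space, expressed via inner products. -/
def WeakConvergesTo {H : Type*} [NormedAddCommGroup H] [InnerProductSpace ℝ H]
    (x : ℕ → H) (p : H) : Prop :=
  ∀ y : H, Tendsto (fun n => ⟪x n, y⟫) atTop (nhds ⟪p, y⟫)

/-- `F` has a strongly-weakly closed graph. -/
def StronglyWeaklyClosedGraph {H : Type*} [NormedAddCommGroup H] [InnerProductSpace ℝ H]
    (F : H → Set H) : Prop :=
  ∀ (xs ys : ℕ → H) (x y : H), WeakConvergesTo xs x → Tendsto ys atTop (nhds y) →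
    (∀ n, ys n ∈ F (xs n)) → y ∈ F x

section WeakConvergence

variable {H : Type*} [NormedAddCommGroup H] [InnerProductSpace ℝ H]

/-- A bounded sequence in a Hilbert space has a weakly convergent subsequence. -/
theorem exists_subseq_weakConvergesTo_of_norm_le [CompleteSpace H] {a : ℕ → H} {C : ℝ}
    (ha : ∀ n, ‖a n‖ ≤ C) :
    ∃ p : H, ∃ φ : ℕ → ℕ, StrictMono φ ∧ WeakConvergesTo (a ∘ φ) p := by
  set K : Submodule ℝ H := (Submodule.span ℝ (Set.range a)).topologicalClosure
  have hsep : TopologicalSpace.IsSeparable (K : Set H) :=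
    (Set.countable_range a).isSeparable.span.closure
  have : TopologicalSpace.SeparableSpace K := hsep.separableSpace
  have : CompleteSpace K :=
    (Submodule.isClosed_topologicalClosure _).completeSpace_coe
  have haK : ∀ n, a n ∈ K := fun n =>
    Submodule.le_topologicalClosure _ (Submodule.subset_span ⟨n, rfl⟩)
  let f : ℕ → WeakDual ℝ K := fun n =>
    StrongDual.toWeakDual (InnerProductSpace.toDual ℝ K ⟨a n, haK n⟩)
  have hf : ∀ n, f n ∈ WeakDual.toStrongDual ⁻¹'
      Metric.closedBall (0 : StrongDual ℝ K) C := by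
    intro n
    have : ‖InnerProductSpace.toDual ℝ K ⟨a n, haK n⟩‖ ≤ C := by
      rw [LinearIsometryEquiv.norm_map]; exact ha n
    exact mem_closedBall_zero_iff.2 this
  obtain ⟨g, -, φ, hφ, hlim⟩ := WeakDual.isSeqCompact_closedBall ℝ K 0 C hf
  set p : K := (InnerProductSpace.toDual ℝ K).symm (WeakDual.toStrongDual g)
  refine ⟨p, φ, hφ, fun y => ?_⟩
  have h := tendsto_iff_forall_eval_tendsto_topDualPairing.1 hlim
    (K.orthogonalProjectionOnto y)
  have hinner : ∀ z : K, ⟪(z : H), y⟫ = ⟪z, K.orthogonalProjectionOnto y⟫ := fun z =>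
    (K.inner_orthogonalProjectionOnto_eq_of_mem_left z y).symm
  rw [hinner p, InnerProductSpace.toDual_symm_apply]
  exact h.congr fun n => (hinner ⟨a (φ n), haK (φ n)⟩).symm

/-- Two weak cluster points coincide when the distances of the sequence to both converge. -/
theorem eq_of_weakConvergesTo_subseq {a : ℕ → H} {p q : H} {φ ψ : ℕ → ℕ} {lp lq : ℝ}
    (hφ : Tendsto φ atTop atTop) (hψ : Tendsto ψ atTop atTop)
    (hp : WeakConvergesTo (a ∘ φ) p) (hq : WeakConvergesTo (a ∘ ψ) q)
    (hlp : Tendsto (fun n => ‖a n - p‖) atTop (nhds lp))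
    (hlq : Tendsto (fun n => ‖a n - q‖) atTop (nhds lq)) : p = q := by
  have hid : ∀ n, ⟪a n, q - p⟫ =
      (‖a n - p‖ ^ 2 - ‖a n - q‖ ^ 2 - ‖p‖ ^ 2 + ‖q‖ ^ 2) / 2 := by
    intro n
    rw [norm_sub_sq_real, norm_sub_sq_real, inner_sub_right]
    ring
  have hlim : Tendsto (fun n => ⟪a n, q - p⟫) atTop
      (nhds ((lp ^ 2 - lq ^ 2 - ‖p‖ ^ 2 + ‖q‖ ^ 2) / 2)) := by
    simp_rw [hid]
    exact ((((hlp.pow 2).sub (hlq.pow 2)).sub_const _).add_const _).div_const 2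
  have hpl := tendsto_nhds_unique (hp (q - p)) (hlim.comp hφ)
  have hql := tendsto_nhds_unique (hq (q - p)) (hlim.comp hψ)
  have hzero : ⟪q - p, q - p⟫ = 0 := by
    rw [inner_sub_left, hpl, hql, sub_self]
  exact (sub_eq_zero.1 (inner_self_eq_zero.1 hzero)).symm

/-- **Opial's lemma** for Fejér monotone sequences. -/
theorem exists_weakConvergesTo_of_antitone_norm_sub [CompleteSpace H] {a : ℕ → H} {S : Set H}
    (hS : S.Nonempty) (hanti : ∀ s ∈ S, Antitone fun n => ‖a n - s‖)
    (hcluster : ∀ (p : H) (φ : ℕ → ℕ), Tendsto φ atTop atTop →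
      WeakConvergesTo (a ∘ φ) p → p ∈ S) :
    ∃ p ∈ S, WeakConvergesTo a p := by
  obtain ⟨s, hs⟩ := hS
  have hbound : ∀ n, ‖a n‖ ≤ ‖a 0 - s‖ + ‖s‖ := fun n =>
    calc ‖a n‖ = ‖(a n - s) + s‖ := by rw [sub_add_cancel]
      _ ≤ ‖a n - s‖ + ‖s‖ := norm_add_le _ _
      _ ≤ ‖a 0 - s‖ + ‖s‖ := by gcongr; exact hanti s hs (Nat.zero_le n)
  have hconv : ∀ q ∈ S, ∃ l, Tendsto (fun n => ‖a n - q‖) atTop (nhds l) := fun q hq =>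
    ⟨_, tendsto_atTop_ciInf (hanti q hq)
      ⟨0, by rintro _ ⟨n, rfl⟩; exact norm_nonneg _⟩⟩
  obtain ⟨p, φ, hφ, hp⟩ := exists_subseq_weakConvergesTo_of_norm_le hbound
  have hpS := hcluster p φ hφ.tendsto_atTop hp
  refine ⟨p, hpS, fun y => tendsto_of_subseq_tendsto fun ns hns => ?_⟩
  obtain ⟨q, ψ, hψ, hq⟩ :=
    exists_subseq_weakConvergesTo_of_norm_le (a := a ∘ ns) fun n => hbound (ns n)
  have hnsψ : Tendsto (ns ∘ ψ) atTop atTop := hns.comp hψ.tendsto_atTop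
  obtain ⟨lp, hlp⟩ := hconv p hpS
  obtain ⟨lq, hlq⟩ := hconv q (hcluster q (ns ∘ ψ) hnsψ hq)
  obtain rfl := eq_of_weakConvergesTo_subseq hφ.tendsto_atTop hnsψ hp hq hlp hlq
  exact ⟨ψ, hq y⟩

end WeakConvergence

/-- If `‖u n‖` is antitone and `∑ γ n ^ 2 * ‖u n‖ ^ 2` converges while `∑ γ n ^ 2` diverges, then
`u` tends to zero. -/
theorem tendsto_zero_of_antitone_norm_of_summable {E : Type*} [NormedAddCommGroup E]
    {u : ℕ → E} {γ : ℕ → ℝ} (hanti : Antitone fun n => ‖u n‖)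
    (hdiv : ¬ Summable fun n => γ n ^ 2) (hsum : Summable fun n => γ n ^ 2 * ‖u n‖ ^ 2) :
    Tendsto u atTop (nhds 0) := by
  refine Metric.tendsto_atTop.2 fun ε hε => ?_
  obtain ⟨N, hN⟩ : ∃ N, ‖u N‖ < ε := by
    by_contra! hge
    refine hdiv (.of_nonneg_of_le (fun n => sq_nonneg _) (fun n => ?_)
      (hsum.div_const (ε ^ 2)))
    rw [le_div_iff₀ (by positivity)]
    gcongr
    exact hge n
  exact ⟨N, fun n hn => by simpa using (hanti hn).trans_lt hN⟩

theorem gppa_weak_convergence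
    {H : Type*} [NormedAddCommGroup H] [InnerProductSpace ℝ H] [CompleteSpace H]
    (F : H → Set H) (v vinv : H → H)
    (hzer : ∃ z : H, (0 : H) ∈ F z)
    (hgraph : StronglyWeaklyClosedGraph F)
    (hbij : Function.Bijective v)
    (hvinv_left : Function.LeftInverse vinv v)
    (hvinv_right : Function.RightInverse vinv v)
    (hmono : MonotonePair F v)
    (hweakcont : ∀ (u : ℕ → H) (p : H), WeakConvergesTo u p →
      WeakConvergesTo (fun n => vinv (u n)) (vinv p))
    (γ : ℕ → ℝ) (hγ : ∀ n, 0 < γ n)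
    (hdiv : ¬ Summable (fun n => (γ n) ^ 2))
    (hran : ∀ n, Set.range v ⊆ {w : H | ∃ z : H, ∃ u ∈ F z, w = γ n • u + v z})
    (x : ℕ → H)
    (hiter : ∀ n, v (x n) - v (x (n + 1)) ∈ γ n • F (x (n + 1))) :
    ∃ xt : H, (0 : H) ∈ F xt ∧ WeakConvergesTo x xt := by
  choose u huF hu using fun n => Set.mem_smul_set.1 (hiter n)
  have hfejer : ∀ z, (0 : H) ∈ F z → ∀ n,
      γ n ^ 2 * ‖u n‖ ^ 2 ≤ ‖v (x n) - v z‖ ^ 2 - ‖v (x (n + 1)) - v z‖ ^ 2 := by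
    intro z hz n
    have hinner := hmono _ _ _ (huF n) _ hz
    rw [sub_zero] at hinner
    have hsplit : v (x n) - v z = γ n • u n + (v (x (n + 1)) - v z) := by
      rw [hu n]; abel
    rw [hsplit, norm_add_sq_real, norm_smul, inner_smul_left, Real.norm_eq_abs, mul_pow, sq_abs]
    have := mul_nonneg (hγ n).le hinner
    simp only [conj_trivial]
    linarith
  have hanti : ∀ z, (0 : H) ∈ F z → Antitone fun n => ‖v (x n) - v z‖ := fun z hz =>
    antitone_nat_of_succ_le fun n => by
      have := hfejer z hz n
      have : 0 ≤ γ n ^ 2 * ‖u n‖ ^ 2 := by positivity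
      exact (sq_le_sq₀ (norm_nonneg _) (norm_nonneg _)).1 (by linarith)
  have hunorm : Antitone fun n => ‖u n‖ := antitone_nat_of_succ_le fun n => by
    have hinner := hmono _ _ _ (huF n) _ (huF (n + 1))
    rw [← hu (n + 1), inner_smul_right] at hinner
    have hinner := nonneg_of_mul_nonneg_right hinner (hγ (n + 1))
    rw [inner_sub_left, real_inner_self_eq_norm_sq] at hinner
    have := real_inner_le_norm (u n) (u (n + 1))
    by_contra! hlt
    nlinarith [norm_nonneg (u n)]
  obtain ⟨z, hz⟩ := hzer
  have hsum : Summable fun n => γ n ^ 2 * ‖u n‖ ^ 2 := by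
    refine summable_of_sum_range_le (c := ‖v (x 0) - v z‖ ^ 2) (fun n => by positivity) fun n => ?_
    refine (Finset.sum_le_sum fun i _ => hfejer z hz i).trans ?_
    rw [Finset.sum_range_sub' fun i => ‖v (x i) - v z‖ ^ 2]
    linarith [sq_nonneg ‖v (x n) - v z‖]
  have hu0 : Tendsto u atTop (nhds 0) :=
    tendsto_zero_of_antitone_norm_of_summable hunorm hdiv hsum
  obtain ⟨p, hp, hlim⟩ := exists_weakConvergesTo_of_antitone_norm_sub
    (a := fun n => v (x (n + 1))) (S := {p | (0 : H) ∈ F (vinv p)})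
    ⟨v z, by simpa [hvinv_left z] using hz⟩
    (fun s hs m n hmn => by
      simpa [hvinv_right s] using hanti (vinv s) hs (Nat.succ_le_succ hmn))
    (fun p φ hφ hp => by
      refine hgraph (fun n => x (φ n + 1)) (u ∘ φ) _ _ ?_ (hu0.comp hφ) fun n => huF (φ n)
      simpa [hvinv_left _] using hweakcont _ _ hp)
  refine ⟨vinv p, hp, fun y => ?_⟩
  have hx := hweakcont _ _ hlim y
  simp only [hvinv_left _] at hx
  exact (tendsto_add_atTop_iff_nat (f := fun n => ⟪x n, y⟫) 1).1 hx
end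

section
/- Let H be a real Hilbert space, F : H ⇉ H a set-valued operator with zer F ≠ ∅, v : H → H a single-valued map, and α > 0 such that the pair (F, v) is α-strongly monotone. Let (γₙ) be a sequence of positive reals with γ := inf γₙ > 0 and ran v ⊆ ran(γₙF + v) for all n. Let (xₙ) be a sequence in H with xₙ₊₁ ∈ J_{γₙF}^v(xₙ) for all n, i.e. v(xₙ) − v(xₙ₊₁) ∈ γₙ F(xₙ₊₁). Then F has exactly one zero x*, and (xₙ) converges strongly to x*. -/
open RealInnerProductSpace Pointwise Filter

/-- One step of the warped proximal iteration decreases the squared distance of `v (x n)` to the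
image of a zero of `F`. -/
theorem StronglyMonotonePair.two_mul_mul_norm_sq_le {H : Type*} [NormedAddCommGroup H]
    [InnerProductSpace ℝ H] {F : H → Set H} {v : H → H} {α : ℝ}
    (hmono : StronglyMonotonePair F v α) {z : H} (hz : (0 : H) ∈ F z) {c : ℝ} (hc : 0 ≤ c)
    {x y : H} (hxy : v x - v y ∈ c • F y) :
    2 * c * α * ‖y - z‖ ^ 2 ≤ ‖v x - v z‖ ^ 2 - ‖v y - v z‖ ^ 2 := by
  obtain ⟨u, hu, huv⟩ := hxy
  have huv : c • u = v x - v y := huv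
  have hm := hmono y z u hu 0 hz
  rw [sub_zero] at hm
  have hsplit : v x - v z = c • u + (v y - v z) := by rw [huv]; abel
  rw [hsplit, norm_add_sq_real, real_inner_smul_left]
  nlinarith [mul_le_mul_of_nonneg_left hm hc, sq_nonneg ‖c • u‖]

/-- The zero of a strongly monotone pair is unique. -/
theorem StronglyMonotonePair.zero_unique {H : Type*} [NormedAddCommGroup H]
    [InnerProductSpace ℝ H] {F : H → Set H} {v : H → H} {α : ℝ}
    (hmono : StronglyMonotonePair F v α) (hα : 0 < α) {y z : H} (hy : (0 : H) ∈ F y)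
    (hz : (0 : H) ∈ F z) : y = z := by
  have hm := hmono y z 0 hy 0 hz
  rw [sub_zero, inner_zero_left] at hm
  have hsq : ‖y - z‖ ^ 2 = 0 := le_antisymm (nonpos_of_mul_nonpos_right hm hα) (sq_nonneg _)
  exact sub_eq_zero.mp (norm_eq_zero.mp (pow_eq_zero_iff two_ne_zero |>.mp hsq))

/-- A sequence dominated by the decrements of a nonnegative sequence tends to zero. -/
theorem tendsto_zero_of_le_sub_succ {a b : ℕ → ℝ} (ha : ∀ n, 0 ≤ a n) (hb : ∀ n, 0 ≤ b n)
    (hab : ∀ n, b n ≤ a n - a (n + 1)) : Tendsto b atTop (nhds 0) := by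
  refine (summable_of_sum_range_le (c := a 0) hb fun n => ?_).tendsto_atTop_zero
  calc ∑ i ∈ Finset.range n, b i ≤ ∑ i ∈ Finset.range n, (a i - a (i + 1)) :=
        Finset.sum_le_sum fun i _ => hab i
    _ = a 0 - a n := Finset.sum_range_sub' a n
    _ ≤ a 0 := sub_le_self _ (ha n)

theorem gppa_strong_convergence
    {H : Type*} [NormedAddCommGroup H] [InnerProductSpace ℝ H] [CompleteSpace H]
    (F : H → Set H) (v : H → H) (α : ℝ) (hα : 0 < α)
    (hzer : ∃ z : H, (0 : H) ∈ F z)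
    (hmono : StronglyMonotonePair F v α)
    (γ : ℕ → ℝ) (hγ : ∀ n, 0 < γ n) (hinf : 0 < ⨅ n, γ n)
    (hran : ∀ n, Set.range v ⊆ {w : H | ∃ z : H, ∃ u ∈ F z, w = γ n • u + v z})
    (x : ℕ → H)
    (hiter : ∀ n, v (x n) - v (x (n + 1)) ∈ γ n • F (x (n + 1))) :
    ∃ xs : H, ((0 : H) ∈ F xs ∧ ∀ z : H, (0 : H) ∈ F z → z = xs) ∧
      Tendsto x atTop (nhds xs) := by
  obtain ⟨z, hz⟩ := hzer
  refine ⟨z, ⟨hz, fun y hy => hmono.zero_unique hα hy hz⟩, ?_⟩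
  set g := ⨅ n, γ n
  have hg : ∀ n, g ≤ γ n := ciInf_le ⟨0, by rintro _ ⟨n, rfl⟩; exact (hγ n).le⟩
  have hpos : 0 < 2 * g * α := by positivity
  have hlim : Tendsto (fun n => 2 * g * α * ‖x (n + 1) - z‖ ^ 2) atTop (nhds 0) := by
    refine tendsto_zero_of_le_sub_succ (a := fun n => ‖v (x n) - v z‖ ^ 2)
      (fun n => by positivity) (fun n => by positivity) fun n => ?_
    refine le_trans ?_ (hmono.two_mul_mul_norm_sq_le hz (hγ n).le (hiter n))
    gcongr
    exact hg n
  have hsq : Tendsto (fun n => ‖x (n + 1) - z‖ ^ 2) atTop (nhds 0) := by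
    simpa only [inv_mul_cancel_left₀ hpos.ne', mul_zero] using hlim.const_mul (2 * g * α)⁻¹
  have hnorm : Tendsto (fun n => ‖x (n + 1) - z‖) atTop (nhds 0) := by
    simpa using hsq.sqrt
  exact (tendsto_add_atTop_iff_nat 1).mp (tendsto_iff_norm_sub_tendsto_zero.mpr hnorm)
end

section
/- Let H be a real Hilbert space, F : H ⇉ H a set-valued operator with zer F ≠ ∅, α > 0, L > 0, and v : H → H a single-valued L-Lipschitz continuous map such that the pair (F, v) is α-strongly monotone. Let (γₙ) be a sequence of positive reals with γ := inf γₙ > 0 and ran v ⊆ ran(γₙF + v) for all n. Let x* be the (unique) zero of F, and let (xₙ) be a sequence in H with xₙ₊₁ ∈ J_{γₙF}^v(xₙ) for all n. Then (v(xₙ)) converges to v(x*) with linear rate κ := 1/(1 + αγL⁻²) < 1: for all n, ‖v(xₙ₊₁) − v(x*)‖ ≤ κ‖v(xₙ) − v(x*)‖, hence ‖v(xₙ) − v(x*)‖ ≤ κⁿ‖v(x₀) − v(x*)‖. -/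
open RealInnerProductSpace Pointwise Filter

/-- If `b - a` has inner product at least `c * ‖a‖ ^ 2` with `a`, then the norm of `a` is at most
`(1 + c)⁻¹` times that of `b`. -/
theorem norm_le_inv_one_add_mul_norm_of_le_inner_sub {H : Type*} [NormedAddCommGroup H]
    [InnerProductSpace ℝ H] {a b : H} {c : ℝ} (hc : 0 ≤ c) (h : c * ‖a‖ ^ 2 ≤ ⟪b - a, a⟫) :
    ‖a‖ ≤ (1 + c)⁻¹ * ‖b‖ := by
  rw [inner_sub_left, real_inner_self_eq_norm_sq] at h
  have hcs : ⟪b, a⟫ ≤ ‖b‖ * ‖a‖ := real_inner_le_norm b a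
  rw [inv_mul_eq_div, le_div_iff₀ (by positivity)]
  rcases (norm_nonneg a).eq_or_lt with ha | ha
  · simp [← ha]
  · exact le_of_mul_le_mul_right (by linarith) ha

/-- A warped resolvent step with step size `γ` of a strongly monotone pair contracts the distance
to a zero, measured through the kernel. -/
theorem StronglyMonotonePair.norm_sub_le_of_mem_smul {H : Type*} [NormedAddCommGroup H]
    [InnerProductSpace ℝ H] {F : H → Set H} {v : H → H} {α L γ g : ℝ} (hα : 0 < α) (hL : 0 < L)
    (hlip : ∀ x y : H, ‖v x - v y‖ ≤ L * ‖x - y‖) (hmono : StronglyMonotonePair F v α)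
    (hg : 0 ≤ g) (hgγ : g ≤ γ) {x z xstar : H} (hxstar : (0 : H) ∈ F xstar)
    (hz : v x - v z ∈ γ • F z) :
    ‖v z - v xstar‖ ≤ (1 + α * g * (L ^ 2)⁻¹)⁻¹ * ‖v x - v xstar‖ := by
  have hγ : 0 ≤ γ := hg.trans hgγ
  obtain ⟨u, hu, huz⟩ := hz
  replace huz : γ • u = v x - v z := huz
  have hmon : α * ‖z - xstar‖ ^ 2 ≤ ⟪u, v z - v xstar⟫ := by
    simpa using hmono z xstar u hu 0 hxstar
  have hsq : (L ^ 2)⁻¹ * ‖v z - v xstar‖ ^ 2 ≤ ‖z - xstar‖ ^ 2 := by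
    rw [inv_mul_le_iff₀ (by positivity), ← mul_pow]
    gcongr
    exact hlip z xstar
  refine norm_le_inv_one_add_mul_norm_of_le_inner_sub (by positivity) ?_
  rw [sub_sub_sub_cancel_right, ← huz, real_inner_smul_left]
  calc α * g * (L ^ 2)⁻¹ * ‖v z - v xstar‖ ^ 2
      = g * (α * ((L ^ 2)⁻¹ * ‖v z - v xstar‖ ^ 2)) := by ring
    _ ≤ γ * (α * ‖z - xstar‖ ^ 2) := by gcongr
    _ ≤ γ * ⟪u, v z - v xstar⟫ := mul_le_mul_of_nonneg_left hmon hγ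

theorem gppa_linear_convergence_of_v
    {H : Type*} [NormedAddCommGroup H] [InnerProductSpace ℝ H] [CompleteSpace H]
    (F : H → Set H) (v : H → H) (α L : ℝ) (hα : 0 < α) (hL : 0 < L)
    (hzer : ∃ z : H, (0 : H) ∈ F z)
    (hlip : ∀ x y : H, ‖v x - v y‖ ≤ L * ‖x - y‖)
    (hmono : StronglyMonotonePair F v α)
    (γ : ℕ → ℝ) (hγ : ∀ n, 0 < γ n) (hinf : 0 < ⨅ n, γ n)
    (hran : ∀ n, Set.range v ⊆ {w : H | ∃ z : H, ∃ u ∈ F z, w = γ n • u + v z})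
    (xstar : H) (hxstar : (0 : H) ∈ F xstar)
    (x : ℕ → H)
    (hiter : ∀ n, v (x n) - v (x (n + 1)) ∈ γ n • F (x (n + 1))) :
    (1 + α * (⨅ n, γ n) * (L ^ 2)⁻¹)⁻¹ < 1 ∧
    (∀ n, ‖v (x (n + 1)) - v xstar‖ ≤
      (1 + α * (⨅ n, γ n) * (L ^ 2)⁻¹)⁻¹ * ‖v (x n) - v xstar‖) ∧
    (∀ n, ‖v (x n) - v xstar‖ ≤
      ((1 + α * (⨅ n, γ n) * (L ^ 2)⁻¹)⁻¹) ^ n * ‖v (x 0) - v xstar‖) := by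
  have hbdd : BddBelow (Set.range γ) := ⟨0, by rintro _ ⟨n, rfl⟩; exact (hγ n).le⟩
  have hstep : ∀ n, ‖v (x (n + 1)) - v xstar‖ ≤
      (1 + α * (⨅ n, γ n) * (L ^ 2)⁻¹)⁻¹ * ‖v (x n) - v xstar‖ := fun n =>
    StronglyMonotonePair.norm_sub_le_of_mem_smul hα hL hlip hmono hinf.le (ciInf_le hbdd n)
      hxstar (hiter n)
  have hc : 0 < α * (⨅ n, γ n) * (L ^ 2)⁻¹ := by positivity
  refine ⟨inv_lt_one_of_one_lt₀ (by linarith), hstep, fun n => ?_⟩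
  induction n with
  | zero => simp
  | succ n ih =>
    rw [pow_succ', mul_assoc]
    exact (hstep n).trans (mul_le_mul_of_nonneg_left ih (by positivity))
end

section
/- Let H be a real Hilbert space, F : H ⇉ H a set-valued operator with zer F ≠ ∅, α > 0, L > 0, and v : H → H a single-valued L-Lipschitz continuous map such that the pair (F, v) is α-strongly monotone. Let (γₙ) be a sequence of positive reals with γ := inf γₙ > 0 and ran v ⊆ ran(γₙF + v) for all n. Let (xₙ) be a sequence with x₀ ∈ ran v and xₙ₊₁ ∈ T_{γₙF}^v(xₙ) for all n. Then F has a unique zero x*, and (xₙ) converges to x̃ := v(x*) with linear rate κ := 1/(1 + αγL⁻²) < 1: for all n, ‖xₙ₊₁ − x̃‖ ≤ κ‖xₙ − x̃‖. -/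
open RealInnerProductSpace Pointwise Filter

/-- One step of the transformed resolvent contracts the distance to the image of a zero. -/
lemma StronglyMonotonePair.norm_sub_le_of_resolvent {H : Type*} [NormedAddCommGroup H]
    [InnerProductSpace ℝ H] {F : H → Set H} {v : H → H} {α L g c : ℝ}
    (hmono : StronglyMonotonePair F v α) (hα : 0 < α) (hL : 0 < L) (hg : 0 < g) (hgc : g ≤ c)
    (hlip : ∀ x y : H, ‖v x - v y‖ ≤ L * ‖x - y‖) {s z y : H} (hs : (0 : H) ∈ F s)
    (hz : y - v z ∈ c • F z) :
    ‖v z - v s‖ ≤ (1 + α * g * (L ^ 2)⁻¹)⁻¹ * ‖y - v s‖ := by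
  obtain ⟨u, hu, hyu⟩ := hz
  have hyu : c • u = y - v z := hyu
  have hmon : α * ‖z - s‖ ^ 2 ≤ ⟪u, v z - v s⟫ := by
    simpa using hmono z s u hu 0 hs
  have hd : (L ^ 2)⁻¹ * ‖v z - v s‖ ^ 2 ≤ ‖z - s‖ ^ 2 := by
    rw [inv_mul_le_iff₀ (by positivity), ← mul_pow]
    exact pow_le_pow_left₀ (norm_nonneg _) (hlip z s) 2
  have hstep : α * g * (L ^ 2)⁻¹ * ‖v z - v s‖ ^ 2 ≤ c * ⟪u, v z - v s⟫ :=
    calc α * g * (L ^ 2)⁻¹ * ‖v z - v s‖ ^ 2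
        = g * (α * ((L ^ 2)⁻¹ * ‖v z - v s‖ ^ 2)) := by ring
      _ ≤ g * (α * ‖z - s‖ ^ 2) := by gcongr
      _ ≤ c * (α * ‖z - s‖ ^ 2) := by gcongr
      _ ≤ c * ⟪u, v z - v s⟫ := by
        have := hg.trans_le hgc
        gcongr
  have hsplit : ⟪y - v s, v z - v s⟫ = c * ⟪u, v z - v s⟫ + ‖v z - v s‖ ^ 2 := by
    rw [← real_inner_smul_left, hyu, ← real_inner_self_eq_norm_sq, ← inner_add_left,
      sub_add_sub_cancel]
  have hcs := real_inner_le_norm (y - v s) (v z - v s)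
  rw [le_inv_mul_iff₀ (by positivity)]
  rcases (norm_nonneg (v z - v s)).eq_or_lt with h0 | hpos
  · simp [← h0]
  · refine le_of_mul_le_mul_right ?_ hpos
    linarith

theorem gppa1_linear_convergence
    {H : Type*} [NormedAddCommGroup H] [InnerProductSpace ℝ H] [CompleteSpace H]
    (F : H → Set H) (v : H → H) (α L : ℝ) (hα : 0 < α) (hL : 0 < L)
    (hzer : ∃ z : H, (0 : H) ∈ F z)
    (hlip : ∀ x y : H, ‖v x - v y‖ ≤ L * ‖x - y‖)
    (hmono : StronglyMonotonePair F v α)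
    (γ : ℕ → ℝ) (hγ : ∀ n, 0 < γ n) (hinf : 0 < ⨅ n, γ n)
    (hran : ∀ n, Set.range v ⊆ {w : H | ∃ z : H, ∃ u ∈ F z, w = γ n • u + v z})
    (x : ℕ → H) (hx0 : x 0 ∈ Set.range v)
    (hiter : ∀ n, ∃ z : H, x n - v z ∈ γ n • F z ∧ x (n + 1) = v z) :
    ∃ xs : H, ((0 : H) ∈ F xs ∧ ∀ z : H, (0 : H) ∈ F z → z = xs) ∧
      (1 + α * (⨅ n, γ n) * (L ^ 2)⁻¹)⁻¹ < 1 ∧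
      ∀ n, ‖x (n + 1) - v xs‖ ≤
        (1 + α * (⨅ n, γ n) * (L ^ 2)⁻¹)⁻¹ * ‖x n - v xs‖ := by
  obtain ⟨s, hs⟩ := hzer
  refine ⟨s, ⟨hs, fun z hz => ?_⟩, inv_lt_one_of_one_lt₀ ?_, fun n => ?_⟩
  · have h : α * ‖z - s‖ ^ 2 ≤ 0 := by simpa using hmono z s 0 hz 0 hs
    have h0 : ‖z - s‖ ^ 2 = 0 := le_antisymm (nonpos_of_mul_nonpos_right h hα) (sq_nonneg _)
    exact sub_eq_zero.mp (norm_eq_zero.mp (pow_eq_zero_iff two_ne_zero |>.mp h0))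
  · exact lt_add_of_pos_right 1 (by positivity)
  · obtain ⟨z, hz, hxz⟩ := hiter n
    have hle : ⨅ n, γ n ≤ γ n :=
      ciInf_le ⟨0, Set.forall_mem_range.mpr fun m => (hγ m).le⟩ n
    rw [hxz]
    exact hmono.norm_sub_le_of_resolvent hα hL hinf hle hlip hs hz
end

section
/- Let H = ℝⁿ, let F : ℝⁿ ⇉ ℝⁿ be a set-valued operator with zer F ≠ ∅ and closed graph, let γ > 0 with ran v ⊆ ran(γF + v), and let v : ℝⁿ → ℝⁿ be a bijective single-valued map such that the pair (F, v) is monotone and the inverse map v⁻¹ is continuous. Let (xₖ) be a sequence with xₖ₊₁ ∈ J_{γF}^v(xₖ) for all k, i.e. v(xₖ) − v(xₖ₊₁) ∈ γF(xₖ₊₁). Then (xₖ) converges to some point x* ∈ zer F. -/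
open RealInnerProductSpace Pointwise Filter

/-- `F` has a closed graph (with respect to strong convergence). -/
def ClosedGraphSV {H : Type*} [NormedAddCommGroup H] [InnerProductSpace ℝ H]
    (F : H → Set H) : Prop :=
  ∀ (xs ys : ℕ → H) (x y : H), Tendsto xs atTop (nhds x) → Tendsto ys atTop (nhds y) →
    (∀ n, ys n ∈ F (xs n)) → y ∈ F x

/-- Consecutive differences vanish along a sequence that is firmly Fejér monotone
with respect to a point. -/
lemma tendsto_sub_succ_of_firmly_fejer {E : Type*} [NormedAddCommGroup E]
    {y : ℕ → E} {c : E}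
    (h : ∀ k, ‖y (k + 1) - c‖ ^ 2 + ‖y k - y (k + 1)‖ ^ 2 ≤ ‖y k - c‖ ^ 2) :
    Tendsto (fun k => y k - y (k + 1)) atTop (nhds 0) := by
  have hanti : Antitone fun k => ‖y k - c‖ ^ 2 :=
    antitone_nat_of_succ_le fun k => by linarith [h k, sq_nonneg ‖y k - y (k + 1)‖]
  have hbdd : BddBelow (Set.range fun k => ‖y k - c‖ ^ 2) :=
    ⟨0, by rintro _ ⟨k, rfl⟩; positivity⟩
  have hlim := tendsto_atTop_ciInf hanti hbdd
  have hdiff := hlim.sub ((tendsto_add_atTop_iff_nat 1).2 hlim)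
  rw [sub_self] at hdiff
  have hsq : Tendsto (fun k => ‖y k - y (k + 1)‖ ^ 2) atTop (nhds 0) :=
    squeeze_zero (fun k => by positivity) (fun k => by linarith [h k]) hdiff
  rw [tendsto_zero_iff_norm_tendsto_zero]
  simpa using hsq.sqrt

/-- A sequence which is Fejér monotone with respect to one of its subsequential limits
converges to it. -/
lemma tendsto_of_antitone_norm_sub_of_subseq {E : Type*} [NormedAddCommGroup E]
    {y : ℕ → E} {p : E} {φ : ℕ → ℕ}
    (hanti : Antitone fun k => ‖y k - p‖) (hφ : StrictMono φ)
    (hlim : Tendsto (y ∘ φ) atTop (nhds p)) : Tendsto y atTop (nhds p) := by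
  rw [tendsto_iff_norm_sub_tendsto_zero] at hlim ⊢
  exact (tendsto_iff_tendsto_subseq_of_antitone hanti hφ.tendsto_atTop).2 hlim

/-- One step of the warped proximal point iteration, measured against a zero of `F`. -/
lemma MonotonePair.norm_sq_add_norm_sq_le {E : Type*} [NormedAddCommGroup E]
    [InnerProductSpace ℝ E] {F : E → Set E} {v : E → E}
    (hmono : MonotonePair F v) {γ : ℝ} (hγ : 0 < γ) {x x' z : E} (hz : 0 ∈ F z)
    (hstep : v x - v x' ∈ γ • F x') :
    ‖v x' - v z‖ ^ 2 + ‖v x - v x'‖ ^ 2 ≤ ‖v x - v z‖ ^ 2 := by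
  obtain ⟨u, hu, huv⟩ := Set.mem_smul_set.1 hstep
  have hinner : 0 ≤ ⟪v x - v x', v x' - v z⟫ := by
    rw [← huv, real_inner_smul_left]
    exact mul_nonneg hγ.le (by simpa using hmono x' z u hu 0 hz)
  have hexp := norm_add_sq_real (v x - v x') (v x' - v z)
  rw [sub_add_sub_cancel] at hexp
  linarith

theorem gppa_convergence_finite_dim
    {n : ℕ} (F : EuclideanSpace ℝ (Fin n) → Set (EuclideanSpace ℝ (Fin n)))
    (v vinv : EuclideanSpace ℝ (Fin n) → EuclideanSpace ℝ (Fin n))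
    (γ : ℝ) (hγ : 0 < γ)
    (hzer : ∃ z, (0 : EuclideanSpace ℝ (Fin n)) ∈ F z)
    (hgraph : ClosedGraphSV F)
    (hbij : Function.Bijective v)
    (hvinv_left : Function.LeftInverse vinv v)
    (hvinv_right : Function.RightInverse vinv v)
    (hmono : MonotonePair F v)
    (hcont : Continuous vinv)
    (hran : Set.range v ⊆
      {w : EuclideanSpace ℝ (Fin n) | ∃ z, ∃ u ∈ F z, w = γ • u + v z})
    (x : ℕ → EuclideanSpace ℝ (Fin n))
    (hiter : ∀ k, v (x k) - v (x (k + 1)) ∈ γ • F (x (k + 1))) :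
    ∃ xs, (0 : EuclideanSpace ℝ (Fin n)) ∈ F xs ∧ Tendsto x atTop (nhds xs) := by
  obtain ⟨z, hz⟩ := hzer
  have hfejer {z} (hz : 0 ∈ F z) (k : ℕ) :=
    hmono.norm_sq_add_norm_sq_le hγ hz (hiter k)
  have hanti {z} (hz : 0 ∈ F z) : Antitone fun k => ‖v (x k) - v z‖ :=
    antitone_nat_of_succ_le fun k =>
      (pow_le_pow_iff_left₀ (norm_nonneg _) (norm_nonneg _) two_ne_zero).1
        (by linarith [hfejer hz k, sq_nonneg ‖v (x k) - v (x (k + 1))‖])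
  have hdiff := tendsto_sub_succ_of_firmly_fejer (y := v ∘ x) (hfejer hz)
  obtain ⟨p, -, φ, hφ, hp⟩ := tendsto_subseq_of_bounded (x := v ∘ x)
    (Metric.isBounded_closedBall (x := v z) (r := ‖v (x 0) - v z‖))
    fun k => mem_closedBall_iff_norm.2 (hanti hz k.zero_le)
  have hdiffφ := hdiff.comp hφ.tendsto_atTop
  have hp_succ : Tendsto (fun k => v (x (φ k + 1))) atTop (nhds p) := by
    simpa [Function.comp_def] using hp.sub hdiffφ
  have hx_succ : Tendsto (fun k => x (φ k + 1)) atTop (nhds (vinv p)) := by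
    simpa [Function.comp_def, hvinv_left _] using (hcont.tendsto p).comp hp_succ
  have hzero : 0 ∈ F (vinv p) :=
    hgraph _ _ _ _ hx_succ (by simpa using hdiffφ.const_smul γ⁻¹)
      fun k => (Set.mem_smul_set_iff_inv_smul_mem₀ hγ.ne' _ _).1 (hiter (φ k))
  have hlim : Tendsto (v ∘ x) atTop (nhds p) :=
    tendsto_of_antitone_norm_sub_of_subseq
      (by simpa [hvinv_right p] using hanti hzero) hφ hp
  refine ⟨vinv p, hzero, ?_⟩
  simpa [Function.comp_def, hvinv_left _] using (hcont.tendsto p).comp hlim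
end

section
/- Let H be a real Hilbert space, F : H ⇉ H a set-valued operator with zer F ≠ ∅, and v : H → H a single-valued map such that the pair (F, v) is monotone and ran(γF + v) = H for some γ > 0. Fix x, x₀ ∈ H and let (αₖ) be a sequence in [0,1] with αₖ → 0, Σₖ αₖ = ∞, and Σₖ |αₖ₊₁ − αₖ| < ∞. Let (xₖ) be generated by the Halpern-type iteration xₖ₊₁ = αₖ x + (1 − αₖ) T_{γF}^v(xₖ) (the transformed resolvent T_{γF}^v being single-valued by monotonicity of (F, v)). Then (xₖ) converges strongly to a point x̃ ∈ v(zer F), i.e. there exists z ∈ H with 0 ∈ F(z) and x̃ = v(z). -/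
open RealInnerProductSpace Pointwise Filter

/-- A perturbed contraction recursion with non-summable gains `a` and asymptotically nonpositive
forcing `b` tends to zero. -/
lemma tendsto_zero_of_le_one_sub_mul_add {s a b : ℕ → ℝ} (hs : ∀ n, 0 ≤ s n)
    (ha : ∀ n, a n ∈ Set.Icc (0 : ℝ) 1) (hasum : ¬ Summable a)
    (hb : ∀ ε > 0, ∀ᶠ n in atTop, b n ≤ ε)
    (hrec : ∀ n, s (n + 1) ≤ (1 - a n) * s n + a n * b n) :
    Tendsto s atTop (nhds 0) := by
  have hdiv : Tendsto (fun n => ∑ i ∈ Finset.range n, a i) atTop atTop :=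
    (not_summable_iff_tendsto_nat_atTop_of_nonneg fun n => (ha n).1).1 hasum
  have hexp : Tendsto (fun n => Real.exp (-∑ i ∈ Finset.range n, a i)) atTop (nhds 0) :=
    Real.tendsto_exp_neg_atTop_nhds_zero.comp hdiv
  refine tendsto_order.2 ⟨fun c hc => Eventually.of_forall fun n => hc.trans_le (hs n), ?_⟩
  intro ε hε
  obtain ⟨N, hN⟩ := eventually_atTop.1 (hb (ε / 2) (half_pos hε))
  set E : ℕ → ℝ := fun n => Real.exp (-∑ i ∈ Finset.range n, a i) with hE
  have hEpos : ∀ n, 0 < E n := fun n => Real.exp_pos _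
  have hEsucc : ∀ n, (1 - a n) * E n ≤ E (n + 1) := by
    intro n
    have h : E (n + 1) = Real.exp (-a n) * E n := by
      simp only [hE, Finset.sum_range_succ, ← Real.exp_add]
      congr 1
      ring
    rw [h]
    exact mul_le_mul_of_nonneg_right (Real.one_sub_le_exp_neg _) (hEpos n).le
  have hK : 0 ≤ s N / E N := div_nonneg (hs N) (hEpos N).le
  have hbound : ∀ n ≥ N, s n ≤ ε / 2 + s N / E N * E n := by
    intro n hn
    induction n, hn using Nat.le_induction with
    | base =>
      rw [div_mul_cancel₀ _ (hEpos N).ne']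
      linarith
    | succ n hn ih =>
      have h1 := mul_le_mul_of_nonneg_left ih (sub_nonneg.2 (ha n).2)
      have h2 := mul_le_mul_of_nonneg_left (hN n hn) (ha n).1
      have h3 := mul_le_mul_of_nonneg_left (hEsucc n) hK
      linarith [hrec n]
  have hlim : Tendsto (fun n => s N / E N * E n) atTop (nhds 0) := by
    simpa using hexp.const_mul (s N / E N)
  filter_upwards [hlim.eventually (gt_mem_nhds (half_pos hε)), eventually_ge_atTop N] with n h1 h2
  linarith [hbound n h2]

/-- Version of the recursion lemma with an additional summable perturbation. -/
lemma tendsto_zero_of_le_one_sub_mul_add_summable {s a c : ℕ → ℝ} (hs : ∀ n, 0 ≤ s n)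
    (ha : ∀ n, a n ∈ Set.Icc (0 : ℝ) 1) (hasum : ¬ Summable a)
    (hc : ∀ n, 0 ≤ c n) (hcsum : Summable c)
    (hrec : ∀ n, s (n + 1) ≤ (1 - a n) * s n + c n) :
    Tendsto s atTop (nhds 0) := by
  set C : ℕ → ℝ := fun n => ∑' i, c (i + n) with hC
  have hC0 : ∀ n, 0 ≤ C n := fun n => tsum_nonneg fun i => hc _
  have hClim : Tendsto C atTop (nhds 0) := tendsto_sum_nat_add c
  have hCsucc : ∀ n, C n = c n + C (n + 1) := by
    intro n
    have h := ((summable_nat_add_iff n).2 hcsum).tsum_eq_zero_add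
    simpa [hC, add_right_comm, add_assoc, add_comm 1 n] using h
  have hlim : Tendsto (fun n => s n + C n) atTop (nhds 0) := by
    refine tendsto_zero_of_le_one_sub_mul_add (b := C) (fun n => add_nonneg (hs n) (hC0 n)) ha hasum
      (fun ε hε => (hClim.eventually (gt_mem_nhds hε)).mono fun n hn => hn.le) fun n => ?_
    linarith [hrec n, hCsucc n]
  exact squeeze_zero hs (fun n => le_add_of_nonneg_right (hC0 n)) hlim

section Halpern

variable {H : Type*} [NormedAddCommGroup H] [InnerProductSpace ℝ H]

/-- If `T` is nonexpansive then `id - T` is monotone. -/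
lemma inner_sub_apply_nonneg_of_nonexpansive {T : H → H}
    (hT : ∀ x y, ‖T x - T y‖ ≤ ‖x - y‖) (x y : H) :
    0 ≤ ⟪(x - T x) - (y - T y), x - y⟫ := by
  have h : (x - T x) - (y - T y) = (x - y) - (T x - T y) := by abel
  rw [h, inner_sub_left, real_inner_self_eq_norm_sq]
  have h1 := real_inner_le_norm (T x - T y) (x - y)
  have h2 := mul_le_mul_of_nonneg_right (hT x y) (norm_nonneg (x - y))
  nlinarith

/-- The implicit regularized equation `z - T z = s (u - z)` is solvable for nonexpansive `T`. -/
lemma exists_sub_apply_eq_smul [CompleteSpace H] {T : H → H}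
    (hT : ∀ x y, ‖T x - T y‖ ≤ ‖x - y‖) (u : H) {s : ℝ} (hs : 0 < s) :
    ∃ z, z - T z = s • (u - z) := by
  have hs1 : 0 < 1 + s := by linarith
  have hlip : LipschitzWith (Real.toNNReal (1 + s)⁻¹)
      (fun z => (1 + s)⁻¹ • (T z + s • u)) := by
    refine LipschitzWith.of_dist_le_mul fun x y => ?_
    rw [dist_eq_norm, dist_eq_norm, ← smul_sub, add_sub_add_right_eq_sub, norm_smul,
      Real.norm_of_nonneg (inv_nonneg.2 hs1.le), Real.coe_toNNReal _ (inv_nonneg.2 hs1.le)]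
    exact mul_le_mul_of_nonneg_left (hT x y) (inv_nonneg.2 hs1.le)
  have hcontr : ContractingWith (Real.toNNReal (1 + s)⁻¹)
      (fun z => (1 + s)⁻¹ • (T z + s • u)) := by
    refine ⟨?_, hlip⟩
    rw [Real.toNNReal_lt_one]
    exact inv_lt_one_of_one_lt₀ (by linarith)
  refine ⟨hcontr.fixedPoint, ?_⟩
  have h : (1 + s)⁻¹ • (T hcontr.fixedPoint + s • u) = hcontr.fixedPoint :=
    hcontr.fixedPoint_isFixedPt
  set z := hcontr.fixedPoint
  have h' : T z + s • u = (1 + s) • z := by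
    rw [← inv_smul_eq_iff₀ hs1.ne', h]
  rw [smul_sub, eq_sub_of_add_eq h']
  module

/-- Along the regularization path, displacements from the anchor are controlled by the growth
of their squared norms. -/
lemma norm_sq_sub_le_of_regularized {T : H → H} (hT : ∀ x y, ‖T x - T y‖ ≤ ‖x - y‖)
    {u y z : H} {r s : ℝ} (hs : 0 ≤ s) (hsr : s < r)
    (hy : y - T y = r • (u - y)) (hz : z - T z = s • (u - z)) :
    ‖z - y‖ ^ 2 ≤ ‖z - u‖ ^ 2 - ‖y - u‖ ^ 2 := by
  have h := inner_sub_apply_nonneg_of_nonexpansive hT z y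
  rw [hy, hz] at h
  have e1 : s • (u - z) - r • (u - y) = r • (y - u) - s • (z - u) := by module
  have e2 : z - y = (z - u) - (y - u) := by abel
  rw [e1, e2] at h
  rw [e2, norm_sub_sq_real]
  rw [inner_sub_left, real_inner_smul_left, real_inner_smul_left, inner_sub_right (y - u),
    inner_sub_right (z - u), real_inner_self_eq_norm_sq, real_inner_self_eq_norm_sq,
    real_inner_comm (z - u) (y - u)] at h
  have hpath : (r + s) * (‖z - u‖ ^ 2 - 2 * ⟪z - u, y - u⟫ + ‖y - u‖ ^ 2)
      ≤ (r - s) * (‖z - u‖ ^ 2 - ‖y - u‖ ^ 2) := by linarith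
  have hnonneg : 0 ≤ ‖z - u‖ ^ 2 - 2 * ⟪z - u, y - u⟫ + ‖y - u‖ ^ 2 := by
    rw [← norm_sub_sq_real]
    positivity
  have hpos : 0 < r + s := by linarith
  have hsq : 0 ≤ ‖z - u‖ ^ 2 - ‖y - u‖ ^ 2 :=
    nonneg_of_mul_nonneg_right ((mul_nonneg hpos.le hnonneg).trans hpath) (sub_pos.2 hsr)
  refine le_of_mul_le_mul_left ?_ hpos
  linarith [mul_nonneg hs hsq]

/-- Solutions of the regularized equation are no farther from the anchor than any fixed point. -/
lemma norm_sub_le_of_regularized {T : H → H} (hT : ∀ x y, ‖T x - T y‖ ≤ ‖x - y‖)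
    {u z p : H} {s : ℝ} (hs : 0 < s) (hz : z - T z = s • (u - z)) (hp : T p = p) :
    ‖z - u‖ ≤ ‖p - u‖ := by
  have h := inner_sub_apply_nonneg_of_nonexpansive hT z p
  have e : z - p = (z - u) - (p - u) := by abel
  rw [hz, hp, sub_self, sub_zero, real_inner_smul_left, ← neg_sub z u, inner_neg_left, e,
    inner_sub_right, real_inner_self_eq_norm_sq] at h
  have h1 := nonneg_of_mul_nonneg_right h hs
  have h2 := real_inner_le_norm (z - u) (p - u)
  by_contra! hlt
  nlinarith [norm_nonneg (p - u)]

/-- The regularization path of a nonexpansive map with a fixed point converges strongly to a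
fixed point. -/
lemma exists_regularized_tendsto [CompleteSpace H] {T : H → H}
    (hT : ∀ x y, ‖T x - T y‖ ≤ ‖x - y‖) (hfix : ∃ p, T p = p) (u : H) :
    ∃ (s : ℕ → ℝ) (z : ℕ → H) (q : H), (∀ k, 0 < s k) ∧
      (∀ k, z k - T (z k) = s k • (u - z k)) ∧ T q = q ∧ Tendsto z atTop (nhds q) := by
  obtain ⟨p, hp⟩ := hfix
  set s : ℕ → ℝ := fun k => 1 / ((k : ℝ) + 1) with hs
  have hspos : ∀ k, 0 < s k := fun k => by positivity
  have hslim : Tendsto s atTop (nhds 0) := tendsto_one_div_add_atTop_nhds_zero_nat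
  have hanti : ∀ k l, k < l → s l < s k := fun k l hkl => Nat.one_div_lt_one_div hkl
  choose z hz using fun k => exists_sub_apply_eq_smul hT u (hspos k)
  have hgrow : ∀ k l, k ≤ l → ‖z l - z k‖ ^ 2 ≤ ‖z l - u‖ ^ 2 - ‖z k - u‖ ^ 2 := by
    intro k l hkl
    rcases hkl.eq_or_lt with rfl | hlt
    · simp
    · exact norm_sq_sub_le_of_regularized hT (hspos l).le (hanti k l hlt) (hz k) (hz l)
  have hmono : Monotone fun k => ‖z k - u‖ ^ 2 := fun k l hkl => by
    have := hgrow k l hkl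
    have := sq_nonneg ‖z l - z k‖
    dsimp only
    linarith
  have hnorm : ∀ k, ‖z k - u‖ ≤ ‖p - u‖ := fun k =>
    norm_sub_le_of_regularized hT (hspos k) (hz k) hp
  have hbdd : BddAbove (Set.range fun k => ‖z k - u‖ ^ 2) := by
    refine ⟨‖p - u‖ ^ 2, ?_⟩
    rintro _ ⟨k, rfl⟩
    exact pow_le_pow_left₀ (norm_nonneg _) (hnorm k) 2
  have hconv := tendsto_atTop_ciSup hmono hbdd
  have hle := le_ciSup hbdd
  set L := ⨆ k, ‖z k - u‖ ^ 2
  have hcauchy : CauchySeq z := by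
    refine cauchySeq_of_le_tendsto_0' (fun k => Real.sqrt (L - ‖z k - u‖ ^ 2)) ?_ ?_
    · intro k l hkl
      rw [dist_comm, dist_eq_norm]
      exact Real.le_sqrt_of_sq_le ((hgrow k l hkl).trans (sub_le_sub_right (hle l) _))
    · simpa using (hconv.const_sub L).sqrt
  obtain ⟨q, hq⟩ := cauchySeq_tendsto_of_complete hcauchy
  refine ⟨s, z, q, hspos, hz, ?_, hq⟩
  have hTcont : Continuous T :=
    (LipschitzWith.of_dist_le_mul (K := 1) fun x y => by
      simpa [dist_eq_norm] using hT x y).continuous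
  have h1 : Tendsto (fun k => z k - T (z k)) atTop (nhds (q - T q)) :=
    hq.sub ((hTcont.tendsto q).comp hq)
  have h2 : Tendsto (fun k => z k - T (z k)) atTop (nhds 0) := by
    simp only [hz]
    simpa using hslim.smul (hq.const_sub u)
  exact (sub_eq_zero.1 (tendsto_nhds_unique h1 h2)).symm

/-- A bounded sequence with vanishing displacement asymptotically satisfies the variational
inequality characterising the limit of the regularization path. -/
lemma eventually_inner_le_of_regularized_tendsto {T : H → H}
    (hT : ∀ x y, ‖T x - T y‖ ≤ ‖x - y‖) {u q : H} {s : ℕ → ℝ} {z : ℕ → H}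
    (hs : ∀ k, 0 < s k) (hz : ∀ k, z k - T (z k) = s k • (u - z k))
    (hzq : Tendsto z atTop (nhds q)) {x : ℕ → H} {R : ℝ} (hx : ∀ n, ‖x n - q‖ ≤ R)
    (hTx : Tendsto (fun n => ‖x n - T (x n)‖) atTop (nhds 0)) {ε : ℝ} (hε : 0 < ε) :
    ∀ᶠ n in atTop, ⟪u - q, x n - q⟫ ≤ ε := by
  have hd : Tendsto (fun k => ‖z k - q‖) atTop (nhds 0) := tendsto_iff_norm_sub_tendsto_zero.1 hzq
  have hlim : Tendsto (fun k => ‖z k - q‖ * R + ‖u - z k‖ * ‖z k - q‖) atTop (nhds 0) := by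
    simpa using (hd.mul_const R).add ((hzq.const_sub u).norm.mul hd)
  obtain ⟨k, hk⟩ := (hlim.eventually (gt_mem_nhds (half_pos hε))).exists
  have hlim' : Tendsto (fun n => ‖x n - T (x n)‖ * (R + ‖z k - q‖) / s k) atTop (nhds 0) := by
    simpa using (hTx.mul_const (R + ‖z k - q‖)).div_const (s k)
  filter_upwards [hlim'.eventually (gt_mem_nhds (half_pos hε))] with n hn
  have hmono := inner_sub_apply_nonneg_of_nonexpansive hT (x n) (z k)
  rw [hz, inner_sub_left, real_inner_smul_left] at hmono
  have hxz : ‖x n - z k‖ ≤ R + ‖z k - q‖ := by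
    have h := norm_sub_le (x n - q) (z k - q)
    rw [sub_sub_sub_cancel_right] at h
    linarith [hx n]
  have h1 := real_inner_le_norm (x n - T (x n)) (x n - z k)
  have h2 := mul_le_mul_of_nonneg_left hxz (norm_nonneg (x n - T (x n)))
  have h3 : ⟪u - z k, x n - z k⟫ ≤ ‖x n - T (x n)‖ * (R + ‖z k - q‖) / s k := by
    rw [le_div_iff₀ (hs k)]
    linarith
  have e : ⟪u - q, x n - q⟫
      = ⟪u - z k, x n - z k⟫ + ⟪z k - q, x n - q⟫ + ⟪u - z k, z k - q⟫ := by
    have e1 : u - q = (u - z k) + (z k - q) := by abel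
    have e2 : x n - z k = (x n - q) - (z k - q) := by abel
    rw [e1, e2, inner_add_left, inner_sub_right _ (x n - q)]
    ring
  have h4 := real_inner_le_norm (z k - q) (x n - q)
  have h5 := mul_le_mul_of_nonneg_left (hx n) (norm_nonneg (z k - q))
  have h6 := real_inner_le_norm (u - z k) (z k - q)
  linarith

/-- Halpern iterates stay in every ball around a fixed point containing the anchor and the
starting point. -/
lemma norm_halpern_sub_le {T : H → H} (hT : ∀ x y, ‖T x - T y‖ ≤ ‖x - y‖)
    {a : ℕ → ℝ} (ha : ∀ k, a k ∈ Set.Icc (0 : ℝ) 1) {u p : H} {x : ℕ → H}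
    (hx : ∀ k, x (k + 1) = a k • u + (1 - a k) • T (x k)) (hp : T p = p) (n : ℕ) :
    ‖x n - p‖ ≤ max ‖x 0 - p‖ ‖u - p‖ := by
  induction n with
  | zero => exact le_max_left _ _
  | succ n ih =>
    have hTn : ‖T (x n) - p‖ ≤ max ‖x 0 - p‖ ‖u - p‖ := by
      have h := hT (x n) p
      rw [hp] at h
      exact h.trans ih
    have e : x (n + 1) - p = a n • (u - p) + (1 - a n) • (T (x n) - p) := by
      rw [hx]
      module
    have h0 := sub_nonneg.2 (ha n).2
    rw [e]
    refine (norm_add_le _ _).trans ?_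
    rw [norm_smul, norm_smul, Real.norm_of_nonneg (ha n).1, Real.norm_of_nonneg h0]
    have h1 := mul_le_mul_of_nonneg_left (le_max_right ‖x 0 - p‖ ‖u - p‖) (ha n).1
    have h2 := mul_le_mul_of_nonneg_left hTn h0
    linarith

/-- Halpern iterations are asymptotically regular. -/
lemma tendsto_norm_halpern_sub_apply {T : H → H} (hT : ∀ x y, ‖T x - T y‖ ≤ ‖x - y‖)
    {a : ℕ → ℝ} (ha : ∀ k, a k ∈ Set.Icc (0 : ℝ) 1) (ha0 : Tendsto a atTop (nhds 0))
    (hasum : ¬ Summable a) (hadiff : Summable fun k => |a (k + 1) - a k|) {u p : H} {x : ℕ → H}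
    (hx : ∀ k, x (k + 1) = a k • u + (1 - a k) • T (x k)) (hp : T p = p) :
    Tendsto (fun n => ‖x n - T (x n)‖) atTop (nhds 0) := by
  set R := max ‖x 0 - p‖ ‖u - p‖
  have huT : ∀ n, ‖u - T (x n)‖ ≤ 2 * R := by
    intro n
    have h1 := norm_halpern_sub_le hT ha hx hp n
    have h2 := hT (x n) p
    rw [hp] at h2
    have h3 := norm_sub_le (u - p) (T (x n) - p)
    rw [sub_sub_sub_cancel_right] at h3
    linarith [le_max_right ‖x 0 - p‖ ‖u - p‖]
  have hR : 0 ≤ 2 * R := (norm_nonneg _).trans (huT 0)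
  have hstep : Tendsto (fun n => ‖x (n + 1) - x n‖) atTop (nhds 0) := by
    refine tendsto_zero_of_le_one_sub_mul_add_summable (a := fun n => a (n + 1))
      (c := fun n => |a (n + 1) - a n| * (2 * R)) (fun n => norm_nonneg _) (fun n => ha _)
      (fun h => hasum ((summable_nat_add_iff 1).1 h)) (fun n => by positivity)
      (hadiff.mul_right _) fun n => ?_
    have e : x (n + 1 + 1) - x (n + 1)
        = (1 - a (n + 1)) • (T (x (n + 1)) - T (x n)) + (a (n + 1) - a n) • (u - T (x n)) := by
      rw [hx (n + 1), hx n]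
      module
    have h0 := sub_nonneg.2 (ha (n + 1)).2
    rw [e]
    refine (norm_add_le _ _).trans ?_
    rw [norm_smul, norm_smul, Real.norm_of_nonneg h0, Real.norm_eq_abs]
    exact add_le_add (mul_le_mul_of_nonneg_left (hT _ _) h0)
      (mul_le_mul_of_nonneg_left (huT n) (abs_nonneg _))
  have hlim : Tendsto (fun n => ‖x (n + 1) - x n‖ + a n * (2 * R)) atTop (nhds 0) := by
    simpa using hstep.add (ha0.mul_const (2 * R))
  refine squeeze_zero (fun n => norm_nonneg _) (fun n => ?_) hlim
  have e : x n - T (x n) = a n • (u - T (x n)) - (x (n + 1) - x n) := by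
    rw [hx n]
    module
  rw [e]
  refine (norm_sub_le _ _).trans ?_
  rw [norm_smul, Real.norm_of_nonneg (ha n).1]
  linarith [mul_le_mul_of_nonneg_left (huT n) (ha n).1]

/-- Strong convergence of the Halpern iteration for a nonexpansive map with a fixed point. -/
theorem exists_fixedPoint_tendsto_halpern [CompleteSpace H] {T : H → H}
    (hT : ∀ x y, ‖T x - T y‖ ≤ ‖x - y‖) (hfix : ∃ p, T p = p)
    {a : ℕ → ℝ} (ha : ∀ k, a k ∈ Set.Icc (0 : ℝ) 1) (ha0 : Tendsto a atTop (nhds 0))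
    (hasum : ¬ Summable a) (hadiff : Summable fun k => |a (k + 1) - a k|) {u : H} {x : ℕ → H}
    (hx : ∀ k, x (k + 1) = a k • u + (1 - a k) • T (x k)) :
    ∃ q, T q = q ∧ Tendsto x atTop (nhds q) := by
  obtain ⟨s, z, q, hs, hz, hq, hzq⟩ := exists_regularized_tendsto hT hfix u
  refine ⟨q, hq, ?_⟩
  have hTx := tendsto_norm_halpern_sub_apply hT ha ha0 hasum hadiff hx hq
  have hsq : Tendsto (fun n => ‖x n - q‖ ^ 2) atTop (nhds 0) := by
    refine tendsto_zero_of_le_one_sub_mul_add (b := fun n => 2 * ⟪u - q, x (n + 1) - q⟫)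
      (fun n => sq_nonneg _) ha hasum (fun ε hε => ?_) fun n => ?_
    · have h := eventually_inner_le_of_regularized_tendsto hT hs hz hzq
        (norm_halpern_sub_le hT ha hx hq) hTx (half_pos hε)
      filter_upwards [(tendsto_add_atTop_nat 1).eventually h] with n hn
      linarith
    · have e : x (n + 1) - q = a n • (u - q) + (1 - a n) • (T (x n) - q) := by
        rw [hx]
        module
      have hTn : ‖T (x n) - q‖ ^ 2 ≤ ‖x n - q‖ ^ 2 := by
        have h := hT (x n) q
        rw [hq] at h
        exact pow_le_pow_left₀ (norm_nonneg _) h 2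
      have h0 := sub_nonneg.2 (ha n).2
      have h1 := mul_le_mul_of_nonneg_left hTn h0
      have h2 := mul_nonneg (mul_nonneg (ha n).1 h0) (sq_nonneg ‖T (x n) - q‖)
      have h3 := mul_nonneg (sq_nonneg (a n)) (sq_nonneg ‖u - q‖)
      rw [e, norm_add_sq_real, norm_smul, norm_smul, Real.norm_of_nonneg (ha n).1,
        Real.norm_of_nonneg h0, inner_add_right]
      simp only [real_inner_smul_left, real_inner_smul_right, real_inner_self_eq_norm_sq]
      linarith
  refine tendsto_iff_norm_sub_tendsto_zero.2 ?_
  simpa [Real.sqrt_sq (norm_nonneg _)] using hsq.sqrt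

/-- The transformed resolvent of a monotone pair is nonexpansive. -/
lemma MonotonePair.norm_sub_le_of_mem_transformedResolvent {F : H → Set H} {v : H → H}
    (h : MonotonePair F v) {γ : ℝ} (hγ : 0 < γ) {x₁ x₂ y₁ y₂ : H}
    (h₁ : y₁ ∈ transformedResolvent F v γ x₁) (h₂ : y₂ ∈ transformedResolvent F v γ x₂) :
    ‖y₁ - y₂‖ ≤ ‖x₁ - x₂‖ := by
  obtain ⟨z₁, ⟨u₁, hu₁, e₁⟩, rfl⟩ := h₁
  obtain ⟨z₂, ⟨u₂, hu₂, e₂⟩, rfl⟩ := h₂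
  have hm := mul_nonneg hγ.le (h z₁ z₂ u₁ hu₁ u₂ hu₂)
  have e : γ • (u₁ - u₂) = (x₁ - x₂) - (v z₁ - v z₂) := by
    simp only at e₁ e₂
    rw [smul_sub, e₁, e₂]
    abel
  rw [← real_inner_smul_left, e, inner_sub_left, real_inner_self_eq_norm_sq] at hm
  have hc := real_inner_le_norm (x₁ - x₂) (v z₁ - v z₂)
  by_contra! hlt
  nlinarith [norm_nonneg (x₁ - x₂)]

/-- Fixed points of the transformed resolvent are exactly the images of the zeros. -/
lemma mem_transformedResolvent_self_iff {F : H → Set H} {v : H → H} {γ : ℝ} (hγ : 0 < γ) {w : H} :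
    w ∈ transformedResolvent F v γ w ↔ ∃ z, (0 : H) ∈ F z ∧ w = v z := by
  refine exists_congr fun z => and_congr_left fun hw => ?_
  rw [hw, sub_self, Set.mem_smul_set_iff_inv_smul_mem₀ hγ.ne', smul_zero]

end Halpern

theorem gppa2_halpern_strong_convergence
    {H : Type*} [NormedAddCommGroup H] [InnerProductSpace ℝ H] [CompleteSpace H]
    (F : H → Set H) (v : H → H) (γ : ℝ) (hγ : 0 < γ)
    (hzer : ∃ z : H, (0 : H) ∈ F z)
    (hmono : MonotonePair F v)
    (hran : {w : H | ∃ z : H, ∃ u ∈ F z, w = γ • u + v z} = Set.univ)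
    (a : ℕ → ℝ) (ha : ∀ k, a k ∈ Set.Icc (0 : ℝ) 1)
    (ha0 : Tendsto a atTop (nhds 0))
    (hasum : ¬ Summable a)
    (hadiff : Summable (fun k => |a (k + 1) - a k|))
    (xanchor : H) (x : ℕ → H)
    (hiter : ∀ k, ∃ y ∈ transformedResolvent F v γ (x k),
      x (k + 1) = a k • xanchor + (1 - a k) • y) :
    ∃ xt : H, (∃ z : H, (0 : H) ∈ F z ∧ xt = v z) ∧ Tendsto x atTop (nhds xt) := by
  have hne : ∀ w, ∃ y, y ∈ transformedResolvent F v γ w := by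
    intro w
    obtain ⟨z, u, hu, rfl⟩ : w ∈ {w : H | ∃ z : H, ∃ u ∈ F z, w = γ • u + v z} :=
      hran ▸ Set.mem_univ w
    exact ⟨v z, z, ⟨u, hu, by simp⟩, rfl⟩
  choose T hTmem using hne
  have huniq : ∀ w y, y ∈ transformedResolvent F v γ w → y = T w := by
    intro w y hy
    have h := hmono.norm_sub_le_of_mem_transformedResolvent hγ hy (hTmem w)
    rwa [sub_self, norm_zero, norm_le_zero_iff, sub_eq_zero] at h
  have hx : ∀ k, x (k + 1) = a k • xanchor + (1 - a k) • T (x k) := by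
    intro k
    obtain ⟨y, hy, hk⟩ := hiter k
    rw [hk, huniq _ _ hy]
  obtain ⟨z, hz⟩ := hzer
  have hfix : T (v z) = v z :=
    (huniq _ _ ((mem_transformedResolvent_self_iff hγ).2 ⟨z, hz, rfl⟩)).symm
  obtain ⟨q, hq, hlim⟩ := exists_fixedPoint_tendsto_halpern
    (fun w w' => hmono.norm_sub_le_of_mem_transformedResolvent hγ (hTmem w) (hTmem w'))
    ⟨v z, hfix⟩ ha ha0 hasum hadiff hx
  have hmem := hTmem q
  rw [hq] at hmem
  exact ⟨q, (mem_transformedResolvent_self_iff hγ).1 hmem, hlim⟩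
end

section
/- Let A be a real symmetric n × n matrix and κ > 0 such that every eigenvalue λ of A satisfies λ = 0 or |λ| > 2κ, and let b ∈ ℝⁿ. Let (xₖ) be a sequence in ℝⁿ satisfying 2Axₖ₊₁ + 2κxₖ₊₁ = Axₖ + 2κxₖ + b for all k (equivalently, Axₖ₊₁ + (A + 2κI)(xₖ₊₁ − xₖ) = b). Then the sequence (‖Axₖ − b‖) is nonincreasing and ‖A²xₖ − Ab‖ → 0 as k → ∞. -/
open RealInnerProductSpace Filter

section Recurrence

variable {E : Type*} [NormedAddCommGroup E] [InnerProductSpace ℝ E] {T : E →ₗ[ℝ] E} {κ : ℝ}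

/-- The residuals of the generalized proximal point iteration satisfy a linear recurrence. -/
theorem residual_recurrence {b : E} {x : ℕ → E}
    (h : ∀ k, (2 : ℝ) • T (x (k + 1)) + (2 * κ) • x (k + 1) = T (x k) + (2 * κ) • x k + b) (k : ℕ) :
    (2 : ℝ) • T (T (x (k + 1)) - b) + (2 * κ) • (T (x (k + 1)) - b) =
      T (T (x k) - b) + (2 * κ) • (T (x k) - b) := by
  have hk := congrArg T (h k)
  simp only [map_add, map_smul] at hk
  simp only [map_sub]
  linear_combination (norm := module) hk

theorem abs_add_two_mul_div_lt_one {l : ℝ} (hκ : 0 < κ) (hl : 2 * κ < |l|) :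
    |(l + 2 * κ) / (2 * l + 2 * κ)| < 1 := by
  have h : |l + 2 * κ| < |2 * l + 2 * κ| := by
    rw [← sq_lt_sq]
    rcases lt_abs.1 hl with h | h <;> nlinarith
  rw [abs_div]
  exact (div_lt_one ((abs_nonneg _).trans_lt h)).2 h

theorem two_mul_add_two_mul_ne_zero {l : ℝ} (hκ : 0 < κ) (hl : l = 0 ∨ 2 * κ < |l|) :
    2 * l + 2 * κ ≠ 0 := by
  rcases hl with rfl | hl
  · simpa using hκ.ne'
  · rcases lt_abs.1 hl with h | h
    · exact (by linarith : 0 < 2 * l + 2 * κ).ne'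
    · exact (by linarith : 2 * l + 2 * κ < 0).ne

variable [FiniteDimensional ℝ E]

theorem inner_eigenvectorBasis_apply (hT : T.IsSymmetric)
    (i : Fin (Module.finrank ℝ E)) (y : E) :
    ⟪hT.eigenvectorBasis rfl i, T y⟫ =
      hT.eigenvalues rfl i * ⟪hT.eigenvectorBasis rfl i, y⟫ := by
  rw [← hT, hT.apply_eigenvectorBasis, real_inner_smul_left]
  rfl

theorem inner_eigenvectorBasis_of_recurrence (hT : T.IsSymmetric) (hκ : 0 < κ)
    (hspec : ∀ i, hT.eigenvalues rfl i = 0 ∨ 2 * κ < |hT.eigenvalues rfl i|) {r s : E}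
    (h : (2 : ℝ) • T s + (2 * κ) • s = T r + (2 * κ) • r) (i : Fin (Module.finrank ℝ E)) :
    ⟪hT.eigenvectorBasis rfl i, s⟫ =
      (hT.eigenvalues rfl i + 2 * κ) / (2 * hT.eigenvalues rfl i + 2 * κ) *
        ⟪hT.eigenvectorBasis rfl i, r⟫ := by
  have hi := congrArg (fun y => ⟪hT.eigenvectorBasis rfl i, y⟫) h
  simp only [inner_add_right, real_inner_smul_right, inner_eigenvectorBasis_apply] at hi
  rw [div_mul_eq_mul_div, eq_div_iff (two_mul_add_two_mul_ne_zero hκ (hspec i))]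
  linear_combination hi

theorem norm_le_of_recurrence (hT : T.IsSymmetric) (hκ : 0 < κ)
    (hspec : ∀ i, hT.eigenvalues rfl i = 0 ∨ 2 * κ < |hT.eigenvalues rfl i|) {r s : E}
    (h : (2 : ℝ) • T s + (2 * κ) • s = T r + (2 * κ) • r) : ‖s‖ ≤ ‖r‖ := by
  rw [← sq_le_sq₀ (norm_nonneg _) (norm_nonneg _),
    ← (hT.eigenvectorBasis rfl).sum_sq_norm_inner_right s,
    ← (hT.eigenvectorBasis rfl).sum_sq_norm_inner_right r]
  refine Finset.sum_le_sum fun i _ => ?_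
  rw [inner_eigenvectorBasis_of_recurrence hT hκ hspec h i, norm_mul]
  gcongr
  refine mul_le_of_le_one_left (norm_nonneg _) ?_
  rcases hspec i with h0 | hl
  · simp [h0, hκ.ne']
  · exact (abs_add_two_mul_div_lt_one hκ hl).le

theorem tendsto_norm_apply_of_recurrence (hT : T.IsSymmetric) (hκ : 0 < κ)
    (hspec : ∀ i, hT.eigenvalues rfl i = 0 ∨ 2 * κ < |hT.eigenvalues rfl i|) {r : ℕ → E}
    (h : ∀ k, (2 : ℝ) • T (r (k + 1)) + (2 * κ) • r (k + 1) = T (r k) + (2 * κ) • r k) :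
    Tendsto (fun k => ‖T (r k)‖) atTop (nhds 0) := by
  rw [← tendsto_zero_iff_norm_tendsto_zero]
  have hcoord : ∀ i, Tendsto (fun k => ⟪hT.eigenvectorBasis rfl i, T (r k)⟫) atTop (nhds 0) := by
    intro i
    simp only [inner_eigenvectorBasis_apply]
    rcases hspec i with h0 | hl
    · simp [h0]
    · have hpow : ∀ k, ⟪hT.eigenvectorBasis rfl i, r k⟫ =
          ((hT.eigenvalues rfl i + 2 * κ) / (2 * hT.eigenvalues rfl i + 2 * κ)) ^ k *
            ⟪hT.eigenvectorBasis rfl i, r 0⟫ := by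
        intro k
        induction k with
        | zero => simp
        | succ k ih =>
          rw [inner_eigenvectorBasis_of_recurrence hT hκ hspec (h k) i, ih]
          ring
      rw [funext fun k => congrArg (hT.eigenvalues rfl i * ·) (hpow k)]
      simpa using ((tendsto_pow_atTop_nhds_zero_of_abs_lt_one
        (abs_add_two_mul_div_lt_one hκ hl)).mul_const _).const_mul _
  have hsum := tendsto_finsetSum Finset.univ fun i _ =>
    (hcoord i).smul_const (hT.eigenvectorBasis rfl i)
  simpa only [(hT.eigenvectorBasis rfl).sum_repr', zero_smul, Finset.sum_const_zero] using hsum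

/-- Convergence of the generalized proximal point iteration for a symmetric operator on a
finite-dimensional real inner product space. -/
theorem gppa_of_isSymmetric (hT : T.IsSymmetric) (hκ : 0 < κ)
    (heig : ∀ (μ : ℝ) (x : E), x ≠ 0 → T x = μ • x → μ = 0 ∨ 2 * κ < |μ|) {b : E} {x : ℕ → E}
    (h : ∀ k, (2 : ℝ) • T (x (k + 1)) + (2 * κ) • x (k + 1) = T (x k) + (2 * κ) • x k + b) :
    Antitone (fun k => ‖T (x k) - b‖) ∧
      Tendsto (fun k => ‖T (T (x k)) - T b‖) atTop (nhds 0) := by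
  have hres := residual_recurrence h
  have hspec : ∀ i, hT.eigenvalues rfl i = 0 ∨ 2 * κ < |hT.eigenvalues rfl i| := fun i =>
    heig _ _ ((hT.eigenvectorBasis rfl).orthonormal.ne_zero i) (hT.apply_eigenvectorBasis rfl i)
  refine ⟨antitone_nat_of_succ_le fun k => norm_le_of_recurrence hT hκ hspec (hres k), ?_⟩
  simpa only [map_sub] using
    tendsto_norm_apply_of_recurrence hT hκ hspec (r := fun k => T (x k) - b) hres

end Recurrence

theorem gppa_least_squares
    {n : ℕ} (A : Matrix (Fin n) (Fin n) ℝ) (hsymm : A.IsSymm) (κ : ℝ) (hκ : 0 < κ)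
    (heig : ∀ (μ : ℝ) (x : EuclideanSpace ℝ (Fin n)), x ≠ 0 →
      Matrix.toEuclideanLin A x = μ • x → μ = 0 ∨ 2 * κ < |μ|)
    (b : EuclideanSpace ℝ (Fin n)) (x : ℕ → EuclideanSpace ℝ (Fin n))
    (hiter : ∀ k, (2 : ℝ) • Matrix.toEuclideanLin A (x (k + 1)) + (2 * κ) • x (k + 1) =
      Matrix.toEuclideanLin A (x k) + (2 * κ) • x k + b) :
    Antitone (fun k => ‖Matrix.toEuclideanLin A (x k) - b‖) ∧
    Tendsto (fun k => ‖Matrix.toEuclideanLin A (Matrix.toEuclideanLin A (x k)) -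
      Matrix.toEuclideanLin A b‖) atTop (nhds 0) := by
  exact gppa_of_isSymmetric (Matrix.isSymmetric_toEuclideanLin_iff.2 <| by
    rwa [Matrix.IsHermitian, Matrix.conjTranspose_eq_transpose_of_trivial]) hκ heig hiter
end
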